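/- Let (L,α) be a regular hom-Lie-Rinehart algebra over (A,φ). Let δ be the coboundary on Alt_A(L,A) with coefficients in the left module (A,φ) (action via the anchor ρ), let ∧ be the shuffle wedge product and Φ the twist map as in the context. Then δ ∘ Φ = Φ ∘ δ, and δ is an (Φ,Φ)-derivation of degree 1: δ(ζ ∧ η) = δ(ζ) ∧ Φ(η) + (−1)^p Φ(ζ) ∧ δ(η) for all ζ ∈ Alt_A^p(L,A), η ∈ Alt_A^q(L,A), p,q ≥ 0. Consequently (Alt_A(L,A), Φ, δ) is a (Φ,Φ)-differential graded commutative algebra. -/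

import Mathlib

/-! Degree-indexed "raw cochains" `∀ p, (Fin p → L) → A` encode the graded algebra
`Alt_A(L,A) = ⊕_p Alt_A^p(L,A)`; a degree-`p` element is supported in arity `p`. -/

/-- Raw cochains on `L` with values in `A`. -/
abbrev RawCochain (L A : Type*) := ∀ p : ℕ, (Fin p → L) → A

/-- Delete the entries at positions `i < j` from an `(n+1)`-tuple and prepend `z`. -/
def consDel {X : Type*} {n : ℕ} (x : Fin (n + 1) → X) (i j : Fin (n + 1)) (h : i < j)
    (z : X) : Fin n → X :=
  have h1 : (i : ℕ) < (j : ℕ) := h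
  have h2 : (j : ℕ) < n + 1 := j.isLt
  have hn : n - 1 + 1 = n := by omega
  have hi : (i : ℕ) < n - 1 + 1 := by omega
  fun t =>
    (Fin.cons z (fun s : Fin (n - 1) =>
      x (j.succAbove (Fin.cast hn ((Fin.castLT i hi).succAbove s)))) : Fin (n - 1 + 1) → X)
      (Fin.cast hn.symm t)

/-- A degree-`m` alternating map, viewed as a raw cochain supported in arity `m`. -/
def ofAlt {A L : Type*} [CommRing A] [AddCommGroup L] [Module A L] (m : ℕ)
    (ξ : AlternatingMap A L A (Fin m)) : RawCochain L A :=
  fun s v => if h : s = m then ξ (fun t => v (Fin.cast h.symm t)) else 0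

/-- The `(p,q)`-shuffles in `S_{p+q}`. -/
def shuffles (p q : ℕ) : Finset (Equiv.Perm (Fin (p + q))) :=
  Finset.univ.filter fun σ =>
    (∀ a b : Fin p, a < b → σ (Fin.castAdd q a) < σ (Fin.castAdd q b)) ∧
    (∀ a b : Fin q, a < b → σ (Fin.natAdd p a) < σ (Fin.natAdd p b))

/-- The shuffle wedge product of raw cochains of degrees `p` and `q`. -/
def wedgeF {A L : Type*} [CommRing A] (p q : ℕ) (ξ η : RawCochain L A) :
    RawCochain L A :=
  fun s v =>
    if h : s = p + q then
      ∑ σ ∈ shuffles p q,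
        ((Equiv.Perm.sign σ : ℤˣ) : ℤ) •
          (ξ p (fun a => v (Fin.cast h.symm (σ (Fin.castAdd q a)))) *
            η q (fun b => v (Fin.cast h.symm (σ (Fin.natAdd p b)))))
    else 0

/-- The twist map `Φ(ξ)(x₁,…,x_p) = φ(ξ(α⁻¹x₁,…,α⁻¹x_p))`. -/
def PhiF {R A L : Type*} [CommRing R] [CommRing A] [Algebra R A]
    [AddCommGroup L] [Module R L] (φ : A ≃ₐ[R] A) (α : L ≃ₗ[R] L)
    (ξ : RawCochain L A) : RawCochain L A :=
  fun p v => φ (ξ p fun t => α.symm (v t))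

/-- The coboundary `δ` (on degree-`p` raw cochains) of a regular hom-Lie-Rinehart
algebra with coefficients in the left module `(A,φ)`, the action being the anchor. -/
def cobF {R A L : Type*} [CommRing R] [CommRing A] [Algebra R A]
    [AddCommGroup L] [Module R L] (φ : A ≃ₐ[R] A) (α : L ≃ₗ[R] L)
    (br : L →ₗ[R] L →ₗ[R] L) (ρ : L →ₗ[R] A →ₗ[R] A)
    (p : ℕ) (f : RawCochain L A) : RawCochain L A :=
  fun s v =>
    if h : s = p + 1 then
      (∑ i : Fin (p + 1), ((-1 : ℤ) ^ (i : ℕ)) •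
          ρ (α.symm (v (Fin.cast h.symm i)))
            (f p fun t => α.symm (v (Fin.cast h.symm (i.succAbove t)))))
      + ∑ i : Fin (p + 1), ∑ j : Fin (p + 1),
          (if hij : i < j then
            ((-1 : ℤ) ^ ((i : ℕ) + (j : ℕ))) •
              φ (f p (consDel (fun t => α.symm (v (Fin.cast h.symm t))) i j hij
                (α.symm (α.symm (br (v (Fin.cast h.symm i)) (v (Fin.cast h.symm j)))))))
          else 0)
    else 0

/-! Cochains on `L` with values in `A` are handled as functions `List L → A`, which makes the
operators of the Cartan calculus structurally recursive and free of degree casts. -/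

namespace ListCochain

variable {A L : Type*}

/-- Contraction with `x`. -/
def contr (x : L) (F : List L → A) : List L → A := fun l => F (x :: l)

section AddCommGroup

variable [AddCommGroup A]

/-- The sign involution `F ↦ (-1)^deg F`. -/
def gradeInvol (F : List L → A) : List L → A := fun l => (-1 : ℤ) ^ l.length • F l

/-- Sign change under adjacent transpositions. -/
def IsAntisymm (F : List L → A) : Prop :=
  ∀ l x y l', F (l ++ x :: y :: l') = -F (l ++ y :: x :: l')

/-- Additivity in each entry. -/
def IsMultiadditive [AddCommGroup L] (F : List L → A) : Prop :=
  ∀ l x y l', F (l ++ (x + y) :: l') = F (l ++ x :: l') + F (l ++ y :: l')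

/-- `F` is concentrated in degree `p`. -/
def IsHomogeneous (p : ℕ) (F : List L → A) : Prop := ∀ l, l.length ≠ p → F l = 0

/-- The Lie derivative along `x` for a bracket `B` and an action `r`. -/
def lieDeriv (B : L → L → L) (r : L → A →+ A) (x : L) : (List L → A) → List L → A
  | F, [] => r x (F [])
  | F, y :: l => lieDeriv B r x (contr y F) l - F (B x y :: l)

/-- The Chevalley–Eilenberg differential, defined through Cartan's formula. -/
def diff (B : L → L → L) (r : L → A →+ A) : (List L → A) → List L → A
  | _, [] => 0
  | F, x :: l => lieDeriv B r x F l - diff B r (contr x F) l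

lemma contr_add (x : L) (F G : List L → A) : contr x (F + G) = contr x F + contr x G := rfl

lemma contr_gradeInvol (x : L) (F : List L → A) :
    contr x (gradeInvol F) = -gradeInvol (contr x F) := by
  ext l
  simp [contr, gradeInvol, pow_succ]

lemma gradeInvol_gradeInvol (F : List L → A) : gradeInvol (gradeInvol F) = F := by
  ext l
  simp [gradeInvol, smul_smul, ← mul_pow]

lemma IsHomogeneous.gradeInvol {p : ℕ} {F : List L → A} (hF : IsHomogeneous p F) :
    gradeInvol F = (-1 : ℤ) ^ p • F := by
  ext l
  by_cases h : l.length = p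
  · simp [ListCochain.gradeInvol, h]
  · simp [ListCochain.gradeInvol, hF l h]

lemma IsHomogeneous.contr {p : ℕ} {F : List L → A} (hF : IsHomogeneous (p + 1) F) (x : L) :
    IsHomogeneous p (contr x F) :=
  fun l hl => hF (x :: l) (by simpa using hl)

lemma IsHomogeneous.contr_eq_zero {F : List L → A} (hF : IsHomogeneous 0 F) (x : L) :
    ListCochain.contr x F = 0 :=
  funext fun l => hF (x :: l) (by simp)

lemma IsAntisymm.contr {F : List L → A} (hF : IsAntisymm F) (a : L) :
    IsAntisymm (contr a F) :=
  fun l => hF (a :: l)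

lemma IsAntisymm.contr_contr {F : List L → A} (hF : IsAntisymm F) (x y : L) :
    ListCochain.contr x (ListCochain.contr y F) =
      -ListCochain.contr y (ListCochain.contr x F) :=
  funext fun l => hF [] y x l

lemma IsAntisymm.gradeInvol {F : List L → A} (hF : IsAntisymm F) :
    IsAntisymm (gradeInvol F) := by
  intro l x y l'
  simp [ListCochain.gradeInvol, hF l x y l']

section Lie

variable (B : L → L → L) (r : L → A →+ A)

lemma contr_lieDeriv (x y : L) (F : List L → A) :
    contr y (lieDeriv B r x F) = lieDeriv B r x (contr y F) - contr (B x y) F := rfl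

lemma contr_diff (x : L) (F : List L → A) :
    contr x (diff B r F) = lieDeriv B r x F - diff B r (contr x F) := rfl

lemma lieDeriv_add (x : L) (F G : List L → A) :
    lieDeriv B r x (F + G) = lieDeriv B r x F + lieDeriv B r x G := by
  ext l
  induction l generalizing F G with
  | nil => simp [lieDeriv]
  | cons y l ih =>
    simp only [lieDeriv, contr_add, ih, Pi.add_apply]
    abel

lemma lieDeriv_neg (x : L) (F : List L → A) : lieDeriv B r x (-F) = -lieDeriv B r x F :=
  map_neg (AddMonoidHom.mk' (lieDeriv B r x) (lieDeriv_add B r x)) F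

lemma lieDeriv_sub (x : L) (F G : List L → A) :
    lieDeriv B r x (F - G) = lieDeriv B r x F - lieDeriv B r x G :=
  map_sub (AddMonoidHom.mk' (lieDeriv B r x) (lieDeriv_add B r x)) F G

lemma lieDeriv_zero (x : L) : lieDeriv B r x 0 = 0 :=
  map_zero (AddMonoidHom.mk' (lieDeriv B r x) (lieDeriv_add B r x))

lemma diff_add (F G : List L → A) : diff B r (F + G) = diff B r F + diff B r G := by
  ext l
  induction l generalizing F G with
  | nil => simp [diff]
  | cons y l ih =>
    simp only [diff, contr_add, ih, Pi.add_apply, lieDeriv_add]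
    abel

lemma diff_neg (F : List L → A) : diff B r (-F) = -diff B r F :=
  map_neg (AddMonoidHom.mk' (diff B r) (diff_add B r)) F

lemma diff_sub (F G : List L → A) : diff B r (F - G) = diff B r F - diff B r G :=
  map_sub (AddMonoidHom.mk' (diff B r) (diff_add B r)) F G

lemma diff_zero : diff B r 0 = 0 :=
  map_zero (AddMonoidHom.mk' (diff B r) (diff_add B r))

lemma gradeInvol_lieDeriv (x : L) (F : List L → A) :
    gradeInvol (lieDeriv B r x F) = lieDeriv B r x (gradeInvol F) := by
  ext l
  induction l generalizing F with
  | nil => simp [gradeInvol, lieDeriv]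
  | cons y l ih =>
    have h := ih (contr y F)
    simp only [lieDeriv, contr_gradeInvol, lieDeriv_neg, Pi.neg_apply, ← h]
    simp only [gradeInvol, lieDeriv, List.length_cons, smul_sub, pow_succ]
    simp

lemma gradeInvol_diff (F : List L → A) :
    gradeInvol (diff B r F) = -diff B r (gradeInvol F) := by
  ext l
  induction l generalizing F with
  | nil => simp [gradeInvol, diff]
  | cons y l ih =>
    have h := ih (contr y F)
    have h' := congrFun (gradeInvol_lieDeriv B r y F) l
    simp only [Pi.neg_apply] at h
    simp only [diff, contr_gradeInvol, diff_neg, Pi.neg_apply, ← h, ← h']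
    simp only [gradeInvol, diff, List.length_cons, smul_sub, pow_succ]
    simp
    abel

variable {B r}

lemma IsHomogeneous.lieDeriv {p : ℕ} {F : List L → A} (hF : IsHomogeneous p F) (x : L) :
    IsHomogeneous p (lieDeriv B r x F) := by
  intro l hl
  induction l generalizing p F with
  | nil => simp [ListCochain.lieDeriv, hF [] hl]
  | cons y l ih =>
    have h : F (B x y :: l) = 0 := hF _ (by simpa using hl)
    obtain _ | p := p
    · simp [ListCochain.lieDeriv, hF.contr_eq_zero, lieDeriv_zero, h]
    · simp [ListCochain.lieDeriv, ih (hF.contr y) (by simpa using hl), h]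

lemma IsHomogeneous.diff {p : ℕ} {F : List L → A} (hF : IsHomogeneous p F) :
    IsHomogeneous (p + 1) (diff B r F) := by
  intro l hl
  induction l generalizing p F with
  | nil => rfl
  | cons y l ih =>
    have h : ListCochain.lieDeriv B r y F l = 0 := hF.lieDeriv y l (by simpa using hl)
    obtain _ | p := p
    · simp [ListCochain.diff, hF.contr_eq_zero, diff_zero, h]
    · simp [ListCochain.diff, ih (hF.contr y) (by simpa using hl), h]

lemma IsAntisymm.lieDeriv {F : List L → A} (hF : IsAntisymm F) (a : L) :
    IsAntisymm (lieDeriv B r a F) := by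
  intro l x y l'
  induction l generalizing F with
  | nil =>
    have h₁ := hF [] x (B a y) l'
    have h₂ := hF [] (B a x) y l'
    simp only [List.nil_append] at h₁ h₂
    rw [List.nil_append, List.nil_append]
    simp only [ListCochain.lieDeriv]
    rw [hF.contr_contr y x, lieDeriv_neg, Pi.neg_apply]
    simp only [ListCochain.contr, h₁, h₂]
    abel
  | cons b l ih =>
    have h := hF (B a b :: l) x y l'
    have h' := ih (hF.contr b)
    simp only [List.cons_append] at h
    simp only [List.cons_append, ListCochain.lieDeriv, h, h']
    abel

section Additive

variable [AddCommGroup L]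

lemma IsMultiadditive.contr {F : List L → A} (hF : IsMultiadditive F) (a : L) :
    IsMultiadditive (contr a F) :=
  fun l => hF (a :: l)

lemma IsMultiadditive.contr_add {F : List L → A} (hF : IsMultiadditive F) (x y : L) :
    ListCochain.contr (x + y) F = ListCochain.contr x F + ListCochain.contr y F :=
  funext fun l => hF [] x y l

lemma IsMultiadditive.contr_neg {F : List L → A} (hF : IsMultiadditive F) (x : L) :
    ListCochain.contr (-x) F = -ListCochain.contr x F :=
  map_neg (AddMonoidHom.mk' (fun x => ListCochain.contr x F) hF.contr_add) x

lemma IsAntisymm.diff (hskew : ∀ x y, B x y = -B y x) {F : List L → A} (hF : IsAntisymm F)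
    (hadd : IsMultiadditive F) : IsAntisymm (diff B r F) := by
  intro l x y l'
  induction l generalizing F with
  | nil =>
    have h : F (B x y :: l') = -F (B y x :: l') := by
      rw [hskew]
      exact congrFun (hadd.contr_neg (B y x)) l'
    simp only [List.nil_append, ListCochain.diff, ListCochain.lieDeriv, h,
      hF.contr_contr x y, diff_neg, Pi.neg_apply]
    abel
  | cons a l ih =>
    simp only [List.cons_append, ListCochain.diff, hF.lieDeriv a l x y l',
      ih (hF.contr a) (hadd.contr a)]
    abel

lemma lieDeriv_bracket
    (hjac : ∀ x y z, B x (B y z) = B (B x y) z + B y (B x z))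
    (hrep : ∀ x y a, r (B x y) a = r x (r y a) - r y (r x a)) {F : List L → A}
    (hF : IsMultiadditive F) (x y : L) :
    lieDeriv B r (B x y) F =
      lieDeriv B r x (lieDeriv B r y F) - lieDeriv B r y (lieDeriv B r x F) := by
  ext l
  induction l generalizing F with
  | nil => simp [lieDeriv, hrep]
  | cons z l ih =>
    have h : F (B x (B y z) :: l) = F (B (B x y) z :: l) + F (B y (B x z) :: l) := by
      rw [hjac]
      exact hF [] _ _ l
    have h' := ih (hF.contr z)
    simp only [Pi.sub_apply] at h'
    simp only [Pi.sub_apply, lieDeriv, contr_lieDeriv, lieDeriv_sub, h, h']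
    abel

lemma lieDeriv_diff
    (hjac : ∀ x y z, B x (B y z) = B (B x y) z + B y (B x z))
    (hrep : ∀ x y a, r (B x y) a = r x (r y a) - r y (r x a)) {F : List L → A}
    (hF : IsMultiadditive F) (x : L) :
    lieDeriv B r x (diff B r F) = diff B r (lieDeriv B r x F) := by
  ext l
  induction l generalizing F with
  | nil => simp [lieDeriv, diff]
  | cons y l ih =>
    have h := congrFun (lieDeriv_bracket hjac hrep hF x y) l
    simp only [Pi.sub_apply] at h
    simp only [Pi.sub_apply, lieDeriv, contr_diff, contr_lieDeriv, diff, lieDeriv_sub, diff_sub,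
      h, ih (hF.contr y)]
    abel

theorem diff_diff
    (hjac : ∀ x y z, B x (B y z) = B (B x y) z + B y (B x z))
    (hrep : ∀ x y a, r (B x y) a = r x (r y a) - r y (r x a)) {F : List L → A}
    (hF : IsMultiadditive F) : diff B r (diff B r F) = 0 := by
  ext l
  induction l generalizing F with
  | nil => rfl
  | cons x l ih =>
    simp [diff, contr_diff, diff_sub, lieDeriv_diff hjac hrep hF, ih (hF.contr x)]

end Additive

end Lie

end AddCommGroup

section Wedge

variable [CommRing A]

/-- The shuffle product, defined by recursion on the arguments. -/
def wedge : (List L → A) → (List L → A) → List L → A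
  | F, G, [] => F [] * G []
  | F, G, x :: l => wedge (contr x F) G l + wedge (gradeInvol F) (contr x G) l

lemma contr_wedge (x : L) (F G : List L → A) :
    contr x (wedge F G) = wedge (contr x F) G + wedge (gradeInvol F) (contr x G) := rfl

lemma gradeInvol_add (F G : List L → A) :
    gradeInvol (F + G) = gradeInvol F + gradeInvol G := by
  ext l
  simp [gradeInvol]

lemma wedge_add_left (F F' G : List L → A) : wedge (F + F') G = wedge F G + wedge F' G := by
  ext l
  induction l generalizing F F' G with
  | nil => simp [wedge, add_mul]
  | cons x l ih =>
    simp only [wedge, contr_add, gradeInvol_add, ih, Pi.add_apply]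
    abel

lemma wedge_add_right (F G G' : List L → A) : wedge F (G + G') = wedge F G + wedge F G' := by
  ext l
  induction l generalizing F G G' with
  | nil => simp [wedge, mul_add]
  | cons x l ih =>
    simp only [wedge, contr_add, ih, Pi.add_apply]
    abel

lemma wedge_neg_left (F G : List L → A) : wedge (-F) G = -wedge F G :=
  map_neg (AddMonoidHom.mk' (fun F => wedge F G) fun F F' => wedge_add_left F F' G) F

lemma wedge_neg_right (F G : List L → A) : wedge F (-G) = -wedge F G :=
  map_neg (AddMonoidHom.mk' (wedge F) (wedge_add_right F)) G

lemma wedge_sub_left (F F' G : List L → A) : wedge (F - F') G = wedge F G - wedge F' G :=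
  map_sub (AddMonoidHom.mk' (fun F => wedge F G) fun F F' => wedge_add_left F F' G) F F'

lemma wedge_sub_right (F G G' : List L → A) : wedge F (G - G') = wedge F G - wedge F G' :=
  map_sub (AddMonoidHom.mk' (wedge F) (wedge_add_right F)) G G'

lemma wedge_zsmul_left (n : ℤ) (F G : List L → A) : wedge (n • F) G = n • wedge F G :=
  map_zsmul (AddMonoidHom.mk' (fun F => wedge F G) fun F F' => wedge_add_left F F' G) n F

lemma wedge_zero_left (G : List L → A) : wedge 0 G = 0 :=
  map_zero (AddMonoidHom.mk' (fun F => wedge F G) fun F F' => wedge_add_left F F' G)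

lemma wedge_zero_right (F : List L → A) : wedge F 0 = 0 :=
  map_zero (AddMonoidHom.mk' (wedge F) (wedge_add_right F))

lemma IsAntisymm.wedge {F G : List L → A} (hF : IsAntisymm F) (hG : IsAntisymm G) :
    IsAntisymm (wedge F G) := by
  intro l x y l'
  induction l generalizing F G with
  | nil =>
    simp only [List.nil_append, ListCochain.wedge, contr_gradeInvol, gradeInvol_gradeInvol,
      wedge_neg_left, hF.contr_contr x y, hG.contr_contr x y, wedge_neg_right, Pi.neg_apply]
    abel
  | cons a l ih =>
    simp only [List.cons_append, ListCochain.wedge, ih (hF.contr a) hG,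
      ih hF.gradeInvol (hG.contr a)]
    abel

lemma IsHomogeneous.wedge {p q : ℕ} {F G : List L → A} (hF : IsHomogeneous p F)
    (hG : IsHomogeneous q G) : IsHomogeneous (p + q) (wedge F G) := by
  intro l hl
  induction l generalizing p q F G with
  | nil =>
    by_cases hp : p = 0
    · simp [ListCochain.wedge, hG [] (by simpa [hp] using hl)]
    · simp [ListCochain.wedge, hF [] (by simpa using Ne.symm hp)]
  | cons x l ih =>
    have h₁ : ListCochain.wedge (ListCochain.contr x F) G l = 0 := by
      obtain _ | p := p
      · simp [hF.contr_eq_zero, wedge_zero_left]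
      · exact ih (hF.contr x) hG (by simp at hl; omega)
    have h₂ : ListCochain.wedge F (ListCochain.contr x G) l = 0 := by
      obtain _ | q := q
      · simp [hG.contr_eq_zero, wedge_zero_right]
      · exact ih hF (hG.contr x) (by simp at hl; omega)
    rw [ListCochain.wedge, h₁, hF.gradeInvol, wedge_zsmul_left, Pi.smul_apply, h₂, smul_zero,
      add_zero]

variable {B : L → L → L} {r : L → A →+ A}

lemma lieDeriv_wedge (hder : ∀ x a b, r x (a * b) = r x a * b + a * r x b) (x : L)
    (F G : List L → A) :
    lieDeriv B r x (wedge F G) = wedge (lieDeriv B r x F) G + wedge F (lieDeriv B r x G) := by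
  ext l
  induction l generalizing F G with
  | nil => simp [lieDeriv, wedge, hder]
  | cons y l ih =>
    have h : wedge F G (B x y :: l) =
      wedge (contr (B x y) F) G l + wedge (gradeInvol F) (contr (B x y) G) l := rfl
    simp only [lieDeriv, contr_wedge, lieDeriv_add, Pi.add_apply, ih, h]
    simp only [wedge, contr_lieDeriv, wedge_sub_left, wedge_sub_right, gradeInvol_lieDeriv,
      Pi.sub_apply]
    abel

theorem diff_wedge (hder : ∀ x a b, r x (a * b) = r x a * b + a * r x b) (F G : List L → A) :
    diff B r (wedge F G) = wedge (diff B r F) G + wedge (gradeInvol F) (diff B r G) := by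
  ext l
  induction l generalizing F G with
  | nil => simp [diff, wedge]
  | cons x l ih =>
    simp only [diff, contr_wedge, diff_add, Pi.add_apply, ih, lieDeriv_wedge hder]
    simp only [wedge, contr_diff, contr_gradeInvol, gradeInvol_diff, gradeInvol_gradeInvol,
      wedge_sub_left, wedge_sub_right, wedge_neg_left, Pi.sub_apply, Pi.neg_apply]
    abel

end Wedge

end ListCochain

lemma consDel_comp {X Y : Type*} (g : X → Y) {n : ℕ} (x : Fin (n + 1) → X) (i j : Fin (n + 1))
    (h : i < j) (z : X) :
    consDel (fun t => g (x t)) i j h (g z) = fun t => g (consDel x i j h z t) := by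
  ext t
  simp only [consDel]
  generalize Fin.cast _ t = u
  refine Fin.cases ?_ (fun u => ?_) u <;> simp

lemma consDel_cons_zero {X : Type*} {n : ℕ} (x : X) (w : Fin (n + 1) → X) (j : Fin (n + 1))
    (h : (0 : Fin (n + 2)) < j.succ) (z : X) :
    consDel (Fin.cons x w : Fin (n + 2) → X) 0 j.succ h z =
      (Fin.cons z fun t => w (j.succAbove t) : Fin (n + 1) → X) := by
  ext t
  refine Fin.cases ?_ (fun u => ?_) t
  · rfl
  · change (Fin.cons x w : Fin (n + 2) → X) (j.succ.succAbove (Fin.succ u)) = _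
    simp

lemma consDel_cons_succ {X : Type*} {n : ℕ} (x : X) (w : Fin (n + 2) → X) (i j : Fin (n + 2))
    (h : i.succ < j.succ) (z : X) :
    consDel (Fin.cons x w : Fin (n + 3) → X) i.succ j.succ h z =
      (Fin.cons z (Fin.cons x fun t => consDel w i j (Fin.succ_lt_succ_iff.1 h) z t.succ) :
        Fin (n + 2) → X) := by
  obtain ⟨i, rfl⟩ : ∃ i' : Fin (n + 1), i'.castSucc = i :=
    Fin.eq_castSucc_of_ne_last
      (ne_of_lt ((Fin.succ_lt_succ_iff.1 h).trans_le (Fin.le_last j)))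
  ext t
  refine Fin.cases rfl (fun u => ?_) t
  change (Fin.cons x w : Fin (n + 3) → X) (j.succ.succAbove (i.succ.succAbove u)) =
    (Fin.cons x fun t => w (j.succAbove (i.succAbove t)) : Fin (n + 1) → X) u
  refine Fin.cases ?_ (fun u => ?_) u <;> simp

namespace ListCochain

section Explicit

variable {A L : Type*} [AddCommGroup A]

lemma lieDeriv_ofFn (B : L → L → L) (r : L → A →+ A) (x : L) {n : ℕ} (F : List L → A)
    (w : Fin n → L) :
    lieDeriv B r x F (List.ofFn w) =
      r x (F (List.ofFn w)) - ∑ j, F (List.ofFn (Function.update w j (B x (w j)))) := by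
  induction n generalizing F with
  | zero => simp [lieDeriv]
  | succ n ih =>
    obtain ⟨y, u, rfl⟩ : ∃ y u, w = Fin.cons y u := ⟨w 0, Fin.tail w, by simp⟩
    simp only [List.ofFn_cons, lieDeriv, ih, Fin.sum_univ_succ, Fin.cons_zero, Fin.cons_succ,
      Fin.update_cons_zero, ← Fin.cons_update, contr]
    abel

lemma IsAntisymm.cons_ofFn_succAbove {F : List L → A} (hF : IsAntisymm F) {n : ℕ}
    (w : Fin (n + 1) → L) (j : Fin (n + 1)) (z : L) :
    F (z :: List.ofFn fun t => w (j.succAbove t)) =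
      (-1 : ℤ) ^ (j : ℕ) • F (List.ofFn (Function.update w j z)) := by
  obtain ⟨y, u, rfl⟩ : ∃ y u, w = Fin.cons y u := ⟨w 0, Fin.tail w, by simp⟩
  induction n generalizing F y with
  | zero =>
    obtain rfl : j = 0 := Fin.fin_one_eq_zero j
    simp
  | succ n ih =>
    refine Fin.cases ?_ (fun j => ?_) j
    · simp [Fin.update_cons_zero]
    · obtain ⟨y', u, rfl⟩ : ∃ y' u', u = Fin.cons y' u' := ⟨u 0, Fin.tail u, by simp⟩
      have h := hF [] z y (List.ofFn fun t => (Fin.cons y' u : Fin (n + 1) → L) (j.succAbove t))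
      have h' := ih (hF.contr y) j y' u
      simp only [List.nil_append] at h
      simp only [ListCochain.contr] at h'
      have h'' : (fun t => (Fin.cons y (Fin.cons y' u) : Fin (n + 2) → L) (j.succ.succAbove t)) =
          (Fin.cons y fun t => (Fin.cons y' u : Fin (n + 1) → L) (j.succAbove t) :
            Fin (n + 1) → L) := by
        ext t
        refine Fin.cases ?_ (fun t => ?_) t <;> simp
      rw [h'', List.ofFn_cons, h, h', ← Fin.cons_update, List.ofFn_cons, Fin.val_succ, pow_succ]
      simp

/-- The Chevalley–Eilenberg formula for the differential. -/
theorem diff_ofFn {B : L → L → L} {r : L → A →+ A} {F : List L → A} (hF : IsAntisymm F) {n : ℕ}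
    (v : Fin (n + 1) → L) :
    diff B r F (List.ofFn v) =
      (∑ i : Fin (n + 1), (-1 : ℤ) ^ (i : ℕ) •
          r (v i) (F (List.ofFn fun t => v (i.succAbove t))))
      + ∑ i : Fin (n + 1), ∑ j : Fin (n + 1),
          if hij : i < j then
            (-1 : ℤ) ^ ((i : ℕ) + (j : ℕ)) • F (List.ofFn (consDel v i j hij (B (v i) (v j))))
          else 0 := by
  induction n generalizing F with
  | zero => simp [diff, lieDeriv]
  | succ n ih =>
    obtain ⟨x, w, rfl⟩ : ∃ x w, v = Fin.cons x w := ⟨v 0, Fin.tail v, by simp⟩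
    have h₁ (i : Fin (n + 1)) :
        (fun t => (Fin.cons x w : Fin (n + 2) → L) (i.succ.succAbove t)) =
          (Fin.cons x fun t => w (i.succAbove t) : Fin (n + 1) → L) := by
      ext t
      refine Fin.cases ?_ (fun t => ?_) t <;> simp
    have h₂ (i j : Fin (n + 1)) (hij : i.succ < j.succ) (z : L) :
        F (List.ofFn (consDel (Fin.cons x w : Fin (n + 2) → L) i.succ j.succ hij z)) =
          -contr x F (List.ofFn (consDel w i j (Fin.succ_lt_succ_iff.1 hij) z)) := by
      obtain _ | n := n
      · exact absurd (Fin.succ_lt_succ_iff.1 hij) (by omega)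
      have h := hF [] z x (List.ofFn fun t =>
        consDel w i j (Fin.succ_lt_succ_iff.1 hij) z t.succ)
      rw [consDel_cons_succ, List.ofFn_cons, List.ofFn_cons, List.ofFn_succ (f := consDel w _ _ _ _)]
      exact h
    simp only [List.ofFn_cons, diff, lieDeriv_ofFn, ih (hF.contr x)]
    rw [Fin.sum_univ_succ (n := n + 1), Fin.sum_univ_succ (n := n + 1)]
    simp only [Fin.sum_univ_succ (n := n + 1), Fin.cons_zero, Fin.cons_succ, h₁, List.ofFn_cons,
      Fin.succ_lt_succ_iff, h₂, Fin.not_lt_zero, lt_irrefl, Fin.succ_pos, dite_true, dite_false,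
      consDel_cons_zero]
    simp only [Fin.val_succ, Fin.val_zero, contr, hF.cons_ofFn_succAbove, zero_add]
    have e₁ (k : ℕ) (a : A) : (-1 : ℤ) ^ (k + 1) • (-1 : ℤ) ^ k • a = -a := by
      rw [smul_smul, ← pow_add, show k + 1 + k = 2 * k + 1 by ring]
      simp [pow_succ, pow_mul]
    have e₂ (k : ℕ) (a : A) : (-1 : ℤ) ^ (k + 1) • a = -((-1 : ℤ) ^ k • a) := by
      simp [pow_succ]
    have e₃ (k l : ℕ) (a : A) :
        (-1 : ℤ) ^ (k + 1 + (l + 1)) • -a = -((-1 : ℤ) ^ (k + l) • a) := by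
      rw [show k + 1 + (l + 1) = k + l + 2 by ring]
      simp [pow_add]
    have e₄ (p : Prop) [Decidable p] (f : p → A) :
        (if h : p then -f h else 0) = -if h : p then f h else 0 := by
      split <;> simp
    have e₅ : (fun t => (Fin.cons x w : Fin (n + 2) → L) (Fin.succAbove 0 t)) = w := by
      ext t
      simp
    simp only [e₁, e₂, e₃, e₄, e₅, Finset.sum_neg_distrib, pow_zero, one_smul]
    abel

end Explicit

end ListCochain

namespace Shuffle

/-- The left block of `Fin m` for `m = p + q`. -/
def inl {p q m : ℕ} (h : m = p + q) (a : Fin p) : Fin m := Fin.cast h.symm (Fin.castAdd q a)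

/-- The right block of `Fin m` for `m = p + q`. -/
def inr {p q m : ℕ} (h : m = p + q) (b : Fin q) : Fin m := Fin.cast h.symm (Fin.natAdd p b)

@[simp] lemma val_inl {p q m : ℕ} (h : m = p + q) (a : Fin p) : (inl h a : ℕ) = a := rfl

@[simp] lemma val_inr {p q m : ℕ} (h : m = p + q) (b : Fin q) : (inr h b : ℕ) = p + b := rfl

/-- The `(p,q)`-shuffles of `Fin m` for `m = p + q`. -/
def perms {p q m : ℕ} (h : m = p + q) : Finset (Equiv.Perm (Fin m)) :=
  Finset.univ.filter fun σ =>
    (∀ a b : Fin p, a < b → σ (inl h a) < σ (inl h b)) ∧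
    (∀ a b : Fin q, a < b → σ (inr h a) < σ (inr h b))

/-- The permutation sending `k` to `0` and the remaining entries according to `τ`. -/
def extend {m : ℕ} (k : Fin (m + 1)) (τ : Equiv.Perm (Fin m)) : Equiv.Perm (Fin (m + 1)) :=
  Equiv.Perm.decomposeFin.symm (0, τ) * k.cycleRange

@[simp] lemma extend_self {m : ℕ} (k : Fin (m + 1)) (τ : Equiv.Perm (Fin m)) :
    extend k τ k = 0 := by
  simp [extend]

@[simp] lemma extend_succAbove {m : ℕ} (k : Fin (m + 1)) (τ : Equiv.Perm (Fin m)) (t : Fin m) :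
    extend k τ (k.succAbove t) = (τ t).succ := by
  simp [extend]

@[simp] lemma extend_zero_succ {m : ℕ} (τ : Equiv.Perm (Fin m)) (t : Fin m) :
    extend 0 τ t.succ = (τ t).succ := by
  simpa using extend_succAbove 0 τ t

lemma sign_extend {m : ℕ} (k : Fin (m + 1)) (τ : Equiv.Perm (Fin m)) :
    Equiv.Perm.sign (extend k τ) = (-1) ^ (k : ℕ) * Equiv.Perm.sign τ := by
  simp [extend, Fin.sign_cycleRange, mul_comm]

lemma extend_injective {m : ℕ} (k : Fin (m + 1)) : Function.Injective (extend k) := by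
  intro τ τ' h
  simpa [extend] using h

lemma exists_extend_eq {m : ℕ} {k : Fin (m + 1)} {σ : Equiv.Perm (Fin (m + 1))}
    (h : σ k = 0) : ∃ τ, extend k τ = σ := by
  refine ⟨(Equiv.Perm.decomposeFin (σ * k.cycleRange⁻¹)).2, ?_⟩
  have h0 : (Equiv.Perm.decomposeFin (σ * k.cycleRange⁻¹)).1 = 0 := by
    have := Equiv.Perm.decomposeFin_symm_apply_zero
      (Equiv.Perm.decomposeFin (σ * k.cycleRange⁻¹)).1
      (Equiv.Perm.decomposeFin (σ * k.cycleRange⁻¹)).2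
    rw [Prod.mk.eta, Equiv.symm_apply_apply] at this
    have hk : k.cycleRange⁻¹ 0 = k :=
      k.cycleRange.injective (by simp)
    rw [← this, Equiv.Perm.mul_apply, hk, h]
  rw [extend, ← h0, Prod.mk.eta, Equiv.symm_apply_apply, inv_mul_cancel_right]

lemma inl_or_inr {p q m : ℕ} (h : m = p + q) (j : Fin m) :
    (∃ a, j = inl h a) ∨ ∃ b, j = inr h b := by
  by_cases hj : (j : ℕ) < p
  · exact Or.inl ⟨⟨j, hj⟩, rfl⟩
  · exact Or.inr ⟨⟨j - p, by omega⟩, Fin.ext (by simp; omega)⟩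

lemma apply_eq_zero {p q m : ℕ} {h : m + 1 = p + q} {σ : Equiv.Perm (Fin (m + 1))}
    (hσ : σ ∈ perms h) :
    (∃ a : Fin p, (a : ℕ) = 0 ∧ σ (inl h a) = 0) ∨
      ∃ b : Fin q, (b : ℕ) = 0 ∧ σ (inr h b) = 0 := by
  simp only [perms, Finset.mem_filter, Finset.mem_univ, true_and] at hσ
  have h0 : σ (σ.symm 0) = 0 := σ.apply_symm_apply 0
  obtain ⟨a, ha⟩ | ⟨b, hb⟩ := inl_or_inr h (σ.symm 0)
  · rw [ha] at h0
    refine Or.inl ⟨a, ?_, h0⟩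
    by_contra hne
    have := hσ.1 ⟨0, by omega⟩ a (Fin.lt_def.2 (Nat.pos_of_ne_zero hne))
    simp [h0] at this
  · rw [hb] at h0
    refine Or.inr ⟨b, ?_, h0⟩
    by_contra hne
    have := hσ.2 ⟨0, by omega⟩ b (Fin.lt_def.2 (Nat.pos_of_ne_zero hne))
    simp [h0] at this

lemma inl_zero {p q m : ℕ} (h : m + 1 = p + 1 + q) : inl h 0 = 0 := rfl

lemma inl_succ {p q m : ℕ} (h : m + 1 = p + 1 + q) (h' : m = p + q) (a : Fin p) :
    inl h a.succ = (inl h' a).succ := by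
  ext
  simp

lemma inr_eq_succ {p q m : ℕ} (h : m + 1 = p + 1 + q) (h' : m = p + q) (b : Fin q) :
    inr h b = (inr h' b).succ := by
  ext
  simp
  omega

lemma inl_eq_inr_succAbove {p q m : ℕ} (h : m + 1 = p + (q + 1)) (h' : m = p + q) (a : Fin p) :
    inl h a = (inr h 0).succAbove (inl h' a) := by
  rw [Fin.succAbove_of_castSucc_lt _ _ (by simp [Fin.lt_def])]
  rfl

lemma inr_succ {p q m : ℕ} (h : m + 1 = p + (q + 1)) (h' : m = p + q) (b : Fin q) :
    inr h b.succ = (inr h 0).succAbove (inr h' b) := by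
  rw [Fin.succAbove_of_le_castSucc _ _ (by simp [Fin.le_def])]
  rfl

lemma extend_zero_mem_perms {p q m : ℕ} (h : m + 1 = p + 1 + q) (h' : m = p + q)
    (τ : Equiv.Perm (Fin m)) : extend 0 τ ∈ perms h ↔ τ ∈ perms h' := by
  simp [perms, Fin.forall_fin_succ, inl_zero, inl_succ h h', inr_eq_succ h h']

lemma extend_inr_mem_perms {p q m : ℕ} (h : m + 1 = p + (q + 1)) (h' : m = p + q)
    (τ : Equiv.Perm (Fin m)) : extend (inr h 0) τ ∈ perms h ↔ τ ∈ perms h' := by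
  simp [perms, Fin.forall_fin_succ, inr_succ h h', inl_eq_inr_succAbove h h']

section Sum

variable {A L : Type*} [CommRing A]

/-- The summand of the shuffle product at the permutation `σ`. -/
def summand {p q m : ℕ} (h : m = p + q) (f : (Fin p → L) → A) (g : (Fin q → L) → A)
    (w : Fin m → L) (σ : Equiv.Perm (Fin m)) : A :=
  ((Equiv.Perm.sign σ : ℤˣ) : ℤ) •
    (f (fun a => w (σ (inl h a))) * g (fun b => w (σ (inr h b))))

lemma sum_filter_zero {p q m : ℕ} (h : m + 1 = p + 1 + q) (h' : m = p + q)
    (f : (Fin (p + 1) → L) → A) (g : (Fin q → L) → A) (x : L) (w : Fin m → L) :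
    ∑ σ ∈ (perms h).filter (fun σ => σ 0 = 0), summand h f g (Fin.cons x w) σ =
      ∑ τ ∈ perms h', summand h' (fun u => f (Fin.cons x u)) g w τ := by
  symm
  refine Finset.sum_nbij (extend 0) ?_ (extend_injective 0).injOn ?_ ?_
  · intro τ hτ
    simpa [extend_zero_mem_perms h h'] using hτ
  · intro σ hσ
    simp only [Finset.coe_filter, Set.mem_ofPred_eq] at hσ
    obtain ⟨τ, rfl⟩ := exists_extend_eq hσ.2
    exact ⟨τ, by simpa [extend_zero_mem_perms h h'] using hσ.1, rfl⟩
  · intro τ _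
    have e₁ : (fun a => (Fin.cons x w : Fin (m + 1) → L) (extend 0 τ (inl h a))) =
        (Fin.cons x fun a => w (τ (inl h' a)) : Fin (p + 1) → L) := by
      ext a
      refine Fin.cases ?_ (fun a => ?_) a
      · simp [inl_zero]
      · simp [inl_succ h h']
    simp [summand, e₁, sign_extend, inr_eq_succ h h']

lemma sum_filter_inr {p q m : ℕ} (h : m + 1 = p + (q + 1)) (h' : m = p + q)
    (f : (Fin p → L) → A) (g : (Fin (q + 1) → L) → A) (x : L) (w : Fin m → L) :
    ∑ σ ∈ (perms h).filter (fun σ => σ (inr h 0) = 0), summand h f g (Fin.cons x w) σ =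
      (-1 : ℤ) ^ p • ∑ τ ∈ perms h', summand h' f (fun u => g (Fin.cons x u)) w τ := by
  symm
  rw [Finset.smul_sum]
  refine Finset.sum_nbij (extend (inr h 0)) ?_ (extend_injective _).injOn ?_ ?_
  · intro τ hτ
    simpa [extend_inr_mem_perms h h'] using hτ
  · intro σ hσ
    simp only [Finset.coe_filter, Set.mem_ofPred_eq] at hσ
    obtain ⟨τ, rfl⟩ := exists_extend_eq hσ.2
    exact ⟨τ, by simpa [extend_inr_mem_perms h h'] using hσ.1, rfl⟩
  · intro τ _
    have e₁ : (fun a => (Fin.cons x w : Fin (m + 1) → L) (extend (inr h 0) τ (inr h a))) =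
        (Fin.cons x fun a => w (τ (inr h' a)) : Fin (q + 1) → L) := by
      ext a
      refine Fin.cases ?_ (fun a => ?_) a
      · simp
      · simp [inr_succ h h']
    simp [summand, e₁, sign_extend, inl_eq_inr_succAbove h h', mul_assoc]

end Sum

end Shuffle

namespace ListCochain

variable {A L : Type*}

/-- The raw cochain of a cochain on lists. -/
def toRaw (F : List L → A) : RawCochain L A := fun _ v => F (List.ofFn v)

/-- The cochain on lists of a raw cochain. -/
def ofRaw (ξ : RawCochain L A) : List L → A := fun l => ξ l.length l.get

lemma toRaw_ofRaw (ξ : RawCochain L A) : toRaw (ofRaw ξ) = ξ := by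
  ext n v
  have h := List.equivSigmaTuple.apply_symm_apply (⟨n, v⟩ : Σ n, Fin n → L)
  exact congrArg (fun y : Σ n, Fin n → L => ξ y.1 y.2) h

lemma toRaw_injective : Function.Injective (toRaw : (List L → A) → RawCochain L A) := by
  intro F G h
  ext l
  simpa [toRaw] using congrFun (congrFun h l.length) l.get

section Wedge

variable [CommRing A]

lemma wedgeF_eq_sum {p q s : ℕ} (h : s = p + q) (ξ η : RawCochain L A) (v : Fin s → L) :
    wedgeF p q ξ η s v = ∑ σ ∈ Shuffle.perms h, Shuffle.summand h (ξ p) (η q) v σ := by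
  subst h
  exact dif_pos rfl

theorem wedgeF_toRaw {p q s : ℕ} {F G : List L → A} (hF : IsHomogeneous p F)
    (hG : IsHomogeneous q G) (v : Fin s → L) :
    wedgeF p q (toRaw F) (toRaw G) s v = wedge F G (List.ofFn v) := by
  by_cases h : s = p + q
  swap
  · rw [hF.wedge hG _ (by simpa using h), wedgeF, dif_neg h]
  rw [wedgeF_eq_sum h]
  induction s generalizing p q F G with
  | zero =>
    obtain ⟨rfl, rfl⟩ : p = 0 ∧ q = 0 := by omega
    simp [Shuffle.perms, Shuffle.summand, toRaw, wedge]
  | succ s ih =>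
    obtain ⟨x, w, rfl⟩ : ∃ x w, v = Fin.cons x w := ⟨v 0, Fin.tail v, by simp⟩
    have hcontr (n : ℕ) (H : List L → A) :
        (fun u : Fin n → L => toRaw H (n + 1) (Fin.cons x u)) = toRaw (contr x H) n := by
      ext u
      simp [toRaw, contr]
    rw [List.ofFn_cons, wedge, hF.gradeInvol, wedge_zsmul_left, Pi.smul_apply]
    obtain _ | p := p <;> obtain _ | q := q
    · omega
    · rw [hF.contr_eq_zero, wedge_zero_left, Pi.zero_apply, zero_add,
        ← ih hF (hG.contr x) w (by omega), ← hcontr,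
        ← Shuffle.sum_filter_inr h (by omega), Finset.filter_true_of_mem]
      intro σ hσ
      obtain ⟨a, -⟩ | ⟨b, hb, hσb⟩ := Shuffle.apply_eq_zero hσ
      · exact a.elim0
      · rwa [show b = 0 from Fin.ext hb] at hσb
    · rw [hG.contr_eq_zero, wedge_zero_right, Pi.zero_apply, smul_zero, add_zero,
        ← ih (hF.contr x) hG w (by omega), ← hcontr,
        ← Shuffle.sum_filter_zero h (by omega), Finset.filter_true_of_mem]
      intro σ hσ
      obtain ⟨a, ha, hσa⟩ | ⟨b, -⟩ := Shuffle.apply_eq_zero hσ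
      · rwa [show a = 0 from Fin.ext ha] at hσa
      · exact b.elim0
    · rw [← ih (hF.contr x) hG w (by omega), ← ih hF (hG.contr x) w (by omega), ← hcontr,
        ← hcontr, ← Shuffle.sum_filter_zero (by omega) (by omega),
        ← Shuffle.sum_filter_inr h (by omega),
        ← Finset.sum_filter_add_sum_filter_not _ (fun σ => σ 0 = 0)]
      congr 2
      refine Finset.filter_congr fun σ hσ => ⟨fun h0 => ?_, fun hk h0 => ?_⟩
      · obtain ⟨a, ha, hσa⟩ | ⟨b, hb, hσb⟩ := Shuffle.apply_eq_zero hσ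
        · rw [show a = 0 from Fin.ext ha] at hσa
          exact absurd hσa h0
        · rwa [show b = 0 from Fin.ext hb] at hσb
      · have := congrArg Fin.val (σ.injective (hk.trans h0.symm))
        simp at this

end Wedge

end ListCochain

namespace ListCochain

section OfAlt

variable {A L : Type*} [CommRing A] [AddCommGroup L] [Module A L]

lemma isHomogeneous_ofAlt (p : ℕ) (ξ : AlternatingMap A L A (Fin p)) :
    IsHomogeneous p (ofRaw (ofAlt p ξ)) :=
  fun _ hl => dif_neg hl

lemma contr_ofAlt (p : ℕ) (ξ : AlternatingMap A L A (Fin (p + 1))) (x : L) :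
    contr x (ofRaw (ofAlt (p + 1) ξ)) = ofRaw (ofAlt p (ξ.curryLeft x)) := by
  ext l
  by_cases h : l.length = p
  · subst h
    simp only [contr, ofRaw, ofAlt, List.length_cons, dite_true, AlternatingMap.curryLeft_apply_apply]
    congr 1
    ext t
    refine Fin.cases ?_ (fun t => ?_) t <;> rfl
  · rw [isHomogeneous_ofAlt p _ l h]
    exact isHomogeneous_ofAlt (p + 1) ξ (x :: l) (by simpa using h)

lemma ofAlt_add (p : ℕ) (ξ ξ' : AlternatingMap A L A (Fin p)) :
    ofRaw (ofAlt p (ξ + ξ')) = ofRaw (ofAlt p ξ) + ofRaw (ofAlt p ξ') := by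
  ext l
  by_cases h : l.length = p <;> simp [ofRaw, ofAlt, h]

lemma isMultiadditive_ofAlt (p : ℕ) (ξ : AlternatingMap A L A (Fin p)) :
    IsMultiadditive (ofRaw (ofAlt p ξ)) := by
  intro l x y l'
  induction l generalizing p with
  | nil =>
    obtain _ | p := p
    · simp [isHomogeneous_ofAlt 0 ξ _]
    · have h := congrFun (contr_ofAlt p ξ (x + y)) l'
      rw [map_add, ofAlt_add, ← contr_ofAlt, ← contr_ofAlt] at h
      exact h
  | cons a l ih =>
    obtain _ | p := p
    · simp [isHomogeneous_ofAlt 0 ξ _]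
    · have h := ih p (ξ.curryLeft a)
      rw [← contr_ofAlt] at h
      exact h

lemma isAntisymm_ofAlt (p : ℕ) (ξ : AlternatingMap A L A (Fin p)) :
    IsAntisymm (ofRaw (ofAlt p ξ)) := by
  intro l x y l'
  induction l generalizing p with
  | nil =>
    obtain _ | _ | p := p
    · simp [isHomogeneous_ofAlt 0 ξ _]
    · simp [isHomogeneous_ofAlt 1 ξ _]
    · have h : (ξ.curryLeft x).curryLeft y + (ξ.curryLeft y).curryLeft x = 0 := by
        have h' := ξ.curryLeft_same (x + y)
        simpa using h'
      have h' := congrFun (ofAlt_add p ((ξ.curryLeft x).curryLeft y)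
        ((ξ.curryLeft y).curryLeft x)) l'
      rw [h, ← contr_ofAlt, ← contr_ofAlt, ← contr_ofAlt, ← contr_ofAlt,
        show ofRaw (ofAlt p (0 : AlternatingMap A L A (Fin p))) l' = 0 by
          simp [ofRaw, ofAlt]] at h'
      exact eq_neg_of_add_eq_zero_left h'.symm
  | cons a l ih =>
    obtain _ | p := p
    · simp [isHomogeneous_ofAlt 0 ξ _]
    · have h := ih p (ξ.curryLeft a)
      rw [← contr_ofAlt] at h
      exact h

end OfAlt

section Twist

variable {R A L : Type*} [CommRing R] [CommRing A] [Algebra R A] [AddCommGroup L] [Module R L]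
  (φ : A ≃ₐ[R] A) (α : L ≃ₗ[R] L)

/-- The twist map on cochains. -/
def twist (F : List L → A) : List L → A := fun l => φ (F (l.map α.symm))

lemma PhiF_toRaw (F : List L → A) : PhiF φ α (toRaw F) = toRaw (twist φ α F) := by
  ext n v
  simp [PhiF, toRaw, twist, List.map_ofFn, Function.comp_def]

variable {φ α}

lemma IsHomogeneous.twist {p : ℕ} {F : List L → A} (hF : IsHomogeneous p F) :
    IsHomogeneous p (twist φ α F) := by
  intro l hl
  rw [ListCochain.twist, hF _ (by simpa using hl), map_zero]

lemma IsAntisymm.twist {F : List L → A} (hF : IsAntisymm F) : IsAntisymm (twist φ α F) := by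
  intro l x y l'
  simp only [ListCochain.twist, List.map_append, List.map_cons]
  rw [hF, map_neg]

lemma IsMultiadditive.twist {F : List L → A} (hF : IsMultiadditive F) :
    IsMultiadditive (twist φ α F) := by
  intro l x y l'
  simp only [ListCochain.twist, List.map_append, List.map_cons, map_add]
  rw [hF, map_add]

variable (φ α)

/-- The bracket `α⁻¹[x,y]`, which is an ordinary Lie bracket. -/
def untwistBracket (br : L →ₗ[R] L →ₗ[R] L) (x y : L) : L := α.symm (br x y)

/-- The action `φ⁻¹ ∘ ρ(x)`, which is by ordinary derivations. -/
def untwistAction (ρ : L →ₗ[R] A →ₗ[R] A) (x : L) : A →+ A :=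
  (φ.symm : A →+ A).comp (ρ x).toAddMonoidHom

variable {φ α} {br : L →ₗ[R] L →ₗ[R] L} {ρ : L →ₗ[R] A →ₗ[R] A}

@[simp] lemma untwistAction_apply (x : L) (a : A) :
    untwistAction φ ρ x a = φ.symm (ρ x a) := rfl

lemma untwistBracket_skew (hskew : ∀ x y, br x y = -br y x) (x y : L) :
    untwistBracket α br x y = -untwistBracket α br y x := by
  rw [untwistBracket, hskew, map_neg, untwistBracket]

lemma untwistBracket_untwistBracket (hα : ∀ x y, α (br x y) = br (α x) (α y)) (x y z : L) :
    untwistBracket α br x (untwistBracket α br y z) = α.symm (α.symm (br (α x) (br y z))) := by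
  apply α.injective
  apply α.injective
  simp [untwistBracket, hα]

lemma untwistBracket_jacobi (hskew : ∀ x y, br x y = -br y x)
    (hα : ∀ x y, α (br x y) = br (α x) (α y))
    (hjacobi : ∀ x y z, br (α x) (br y z) + br (α y) (br z x) + br (α z) (br x y) = 0)
    (x y z : L) :
    untwistBracket α br x (untwistBracket α br y z) =
      untwistBracket α br (untwistBracket α br x y) z +
        untwistBracket α br y (untwistBracket α br x z) := by
  rw [untwistBracket_skew hskew (untwistBracket α br x y) z]
  simp only [untwistBracket_untwistBracket hα]
  rw [← map_neg, ← map_neg, ← map_add, ← map_add]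
  congr 2
  have h := hjacobi x y z
  rw [hskew z x, map_neg] at h
  rw [← sub_eq_zero, ← h]
  abel

lemma untwistAction_bracket (hrep1 : ∀ x a, ρ (α x) (φ a) = φ (ρ x a))
    (hrep2 : ∀ x y a, ρ (br x y) (φ a) = ρ (α x) (ρ y a) - ρ (α y) (ρ x a)) (x y : L) (a : A) :
    untwistAction φ ρ (untwistBracket α br x y) a =
      untwistAction φ ρ x (untwistAction φ ρ y a) -
        untwistAction φ ρ y (untwistAction φ ρ x a) := by
  apply φ.injective
  apply φ.injective
  simp [untwistBracket, ← hrep1, hrep2]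

lemma untwistAction_mul (hder : ∀ x a b, ρ x (a * b) = φ a * ρ x b + φ b * ρ x a) (x : L)
    (a b : A) :
    untwistAction φ ρ x (a * b) = untwistAction φ ρ x a * b + a * untwistAction φ ρ x b := by
  simp [hder, mul_comm, add_comm]

lemma cobF_toRaw (hrep1 : ∀ x a, ρ (α x) (φ a) = φ (ρ x a)) {p : ℕ} {F : List L → A}
    (hF : IsAntisymm F) (hp : IsHomogeneous p F) :
    cobF φ α br ρ p (toRaw F) =
      toRaw (diff (untwistBracket α br) (untwistAction φ ρ) (twist φ α F)) := by
  ext s v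
  by_cases h : s = p + 1
  · subst h
    have h₁ (x : L) (a : A) : φ.symm (ρ x (φ a)) = ρ (α.symm x) a := by
      rw [φ.symm_apply_eq, ← hrep1, α.apply_symm_apply]
    have h₂ (i j : Fin (p + 1)) (hij : i < j) (z : L) :
        (List.ofFn (consDel v i j hij z)).map α.symm =
          List.ofFn (consDel (fun t => α.symm (v t)) i j hij (α.symm z)) := by
      rw [List.map_ofFn, consDel_comp]
      rfl
    simp only [cobF, dite_true, toRaw, diff_ofFn hF.twist, twist, untwistAction_apply, h₁, h₂,
      untwistBracket, List.map_ofFn]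
    rfl
  · rw [toRaw, hp.twist.diff _ (by simpa using h), cobF, dif_neg h]

lemma cobF_PhiF (hα : ∀ x y, α (br x y) = br (α x) (α y))
    (hrep1 : ∀ x a, ρ (α x) (φ a) = φ (ρ x a)) (p : ℕ) (ξ : RawCochain L A) :
    cobF φ α br ρ p (PhiF φ α ξ) = PhiF φ α (cobF φ α br ρ p ξ) := by
  have hα' (x y : L) : α.symm (br x y) = br (α.symm x) (α.symm y) := by
    rw [α.symm_apply_eq, hα, α.apply_symm_apply, α.apply_symm_apply]
  have hrep (x : L) (a : A) : ρ x (φ a) = φ (ρ (α.symm x) a) := by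
    rw [← hrep1, α.apply_symm_apply]
  ext s v
  by_cases h : s = p + 1
  · subst h
    have h₁ (q : Prop) [Decidable q] (f : q → A) :
        φ (if h : q then f h else 0) = if h : q then φ (f h) else 0 := by
      split <;> simp
    simp only [cobF, PhiF, dite_true, map_add, map_sum, map_zsmul, hrep, h₁, ← consDel_comp]
    simp only [hα']
  · simp [cobF, PhiF, h]

lemma PhiF_wedgeF (p q : ℕ) (ξ η : RawCochain L A) :
    PhiF φ α (wedgeF p q ξ η) = wedgeF p q (PhiF φ α ξ) (PhiF φ α η) := by
  ext s v
  by_cases h : s = p + q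
  · simp only [wedgeF, PhiF, h, dite_true, map_sum, map_zsmul, map_mul]
  · simp [wedgeF, PhiF, h]

end Twist

end ListCochain

open ListCochain

/-- For a regular hom-Lie-Rinehart algebra `(L,α)` over `(A,φ)`, the
coboundary `δ` of `Alt_A(L,A)` with coefficients in `(A,φ)` commutes with the twist
map `Φ` and is a `(Φ,Φ)`-derivation of degree 1 for the shuffle wedge product;
together with `δ² = 0` and multiplicativity of `Φ`, this makes `(Alt_A(L,A), Φ, δ)`
a `(Φ,Φ)`-differential graded commutative algebra. -/
theorem coboundary_derivation_dgca
    {R A L : Type*} [CommRing R] [CommRing A] [Algebra R A]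
    [AddCommGroup L] [Module R L] [Module A L] [IsScalarTower R A L]
    -- the regular hom-Lie-Rinehart algebra structure
    (φ : A ≃ₐ[R] A)
    (br : L →ₗ[R] L →ₗ[R] L)
    (α : L ≃ₗ[R] L)
    (ρ : L →ₗ[R] A →ₗ[R] A)
    (hskew : ∀ x y : L, br x y = - br y x)
    (hα_br : ∀ x y : L, α (br x y) = br (α x) (α y))
    (hjacobi : ∀ x y z : L,
      br (α x) (br y z) + br (α y) (br z x) + br (α z) (br x y) = 0)
    (hα_smul : ∀ (a : A) (x : L), α (a • x) = φ a • α x)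
    (hρ_smul : ∀ (a : A) (x : L) (b : A), ρ (a • x) b = φ a * ρ x b)
    (hρ_der : ∀ (x : L) (a b : A), ρ x (a * b) = φ a * ρ x b + φ b * ρ x a)
    (hρ_rep1 : ∀ (x : L) (a : A), ρ (α x) (φ a) = φ (ρ x a))
    (hρ_rep2 : ∀ (x y : L) (a : A),
      ρ (br x y) (φ a) = ρ (α x) (ρ y a) - ρ (α y) (ρ x a))
    (hleibniz : ∀ (x : L) (a : A) (y : L),
      br x (a • y) = φ a • br x y + ρ x a • α y) :
    -- `δ ∘ Φ = Φ ∘ δ`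
    (∀ (p : ℕ) (ξ : AlternatingMap A L A (Fin p)) (s : ℕ) (v : Fin s → L),
      cobF φ α br ρ p (PhiF φ α (ofAlt p ξ)) s v
        = PhiF φ α (cobF φ α br ρ p (ofAlt p ξ)) s v) ∧
    -- `δ(ζ ∧ η) = δ(ζ) ∧ Φ(η) + (−1)^p Φ(ζ) ∧ δ(η)`
    (∀ (p q : ℕ) (ζ : AlternatingMap A L A (Fin p)) (η : AlternatingMap A L A (Fin q))
      (s : ℕ) (v : Fin s → L),
      cobF φ α br ρ (p + q) (wedgeF p q (ofAlt p ζ) (ofAlt q η)) s v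
        = wedgeF (p + 1) q (cobF φ α br ρ p (ofAlt p ζ)) (PhiF φ α (ofAlt q η)) s v
          + ((-1 : ℤ) ^ p) •
              wedgeF p (q + 1) (PhiF φ α (ofAlt p ζ)) (cobF φ α br ρ q (ofAlt q η)) s v) ∧
    -- `δ² = 0`
    (∀ (p : ℕ) (ξ : AlternatingMap A L A (Fin p)) (s : ℕ) (v : Fin s → L),
      cobF φ α br ρ (p + 1) (cobF φ α br ρ p (ofAlt p ξ)) s v = 0) ∧
    -- `Φ` is multiplicative for the wedge product
    (∀ (p q : ℕ) (ζ : AlternatingMap A L A (Fin p)) (η : AlternatingMap A L A (Fin q))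
      (s : ℕ) (v : Fin s → L),
      PhiF φ α (wedgeF p q (ofAlt p ζ) (ofAlt q η)) s v
        = wedgeF p q (PhiF φ α (ofAlt p ζ)) (PhiF φ α (ofAlt q η)) s v) := by
  have hcob := fun (p : ℕ) (ξ : RawCochain L A) => cobF_PhiF hα_br hρ_rep1 p ξ
  refine ⟨fun p ξ s v => ?_, fun p q ζ η s v => ?_, fun p ξ s v => ?_, fun p q ζ η s v => ?_⟩
  · rw [hcob]
  · rw [← toRaw_ofRaw (ofAlt p ζ), ← toRaw_ofRaw (ofAlt q η)]
    have hF := isHomogeneous_ofAlt p ζ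
    have hF' := isAntisymm_ofAlt p ζ
    have hG := isHomogeneous_ofAlt q η
    have hG' := isAntisymm_ofAlt q η
    generalize ofRaw (ofAlt p ζ) = F at hF hF'
    generalize ofRaw (ofAlt q η) = G at hG hG'
    have hwedge : wedgeF p q (toRaw F) (toRaw G) = toRaw (wedge F G) := by
      ext s v
      exact wedgeF_toRaw hF hG v
    have htwist : twist φ α (wedge F G) = wedge (twist φ α F) (twist φ α G) := by
      apply toRaw_injective
      rw [← PhiF_toRaw, ← hwedge, PhiF_wedgeF, PhiF_toRaw, PhiF_toRaw]
      ext s v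
      exact wedgeF_toRaw hF.twist hG.twist v
    rw [hwedge, cobF_toRaw hρ_rep1 (hF'.wedge hG') (hF.wedge hG), htwist,
      diff_wedge (untwistAction_mul hρ_der), hF.twist.gradeInvol, wedge_zsmul_left,
      cobF_toRaw hρ_rep1 hF' hF, cobF_toRaw hρ_rep1 hG' hG, PhiF_toRaw, PhiF_toRaw,
      wedgeF_toRaw hF.twist.diff hG.twist, wedgeF_toRaw hF.twist hG.twist.diff]
    rfl
  · rw [← toRaw_ofRaw (ofAlt p ξ)]
    have hF := isHomogeneous_ofAlt p ξ
    have hF' := isAntisymm_ofAlt p ξ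
    have hF'' := isMultiadditive_ofAlt p ξ
    generalize ofRaw (ofAlt p ξ) = F at hF hF' hF''
    have htwist : twist φ α (diff (untwistBracket α br) (untwistAction φ ρ) (twist φ α F)) =
        diff (untwistBracket α br) (untwistAction φ ρ) (twist φ α (twist φ α F)) := by
      apply toRaw_injective
      rw [← PhiF_toRaw, ← cobF_toRaw hρ_rep1 hF' hF, ← hcob, PhiF_toRaw,
        cobF_toRaw hρ_rep1 hF'.twist hF.twist]
    rw [cobF_toRaw hρ_rep1 hF' hF,
      cobF_toRaw hρ_rep1 (hF'.twist.diff (untwistBracket_skew hskew) hF''.twist) hF.twist.diff,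
      htwist, diff_diff (untwistBracket_jacobi hskew hα_br hjacobi)
        (untwistAction_bracket hρ_rep1 hρ_rep2) hF''.twist.twist]
    rfl
  · rw [PhiF_wedgeF]
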